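/- For any point placement P of n points, 4·P₅(P) = 4·C(n,5) − Σ_T β_T·γ_T, where the sum ranges over all 3-element subsets T of P. -/

import Mathlib

open Finset

/-- A finite set of points in the plane is in *general position* if no three of
its points are collinear. -/
def GenPos (P : Finset (ℝ × ℝ)) : Prop :=
  ∀ x ∈ P, ∀ y ∈ P, ∀ z ∈ P, x ≠ y → x ≠ z → y ≠ z →
    ¬ Collinear ℝ ({x, y, z} : Set (ℝ × ℝ))

/-- A finite set of points is in *convex position* if every point of it is an
extreme point of its convex hull. -/
def ConvexPos (S : Finset (ℝ × ℝ)) : Prop :=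
  ∀ x ∈ S, x ∈ Set.extremePoints ℝ (convexHull ℝ (S : Set (ℝ × ℝ)))

open scoped Classical in
/-- Number of `k`-element subsets of `P` that are in convex position. -/
noncomputable def convexPosCount (P : Finset (ℝ × ℝ)) (k : ℕ) : ℕ :=
  ((P.powersetCard k).filter fun S => ConvexPos S).card

/-- `mu k n` is the minimum number of `k`-element subsets in convex position over
all placements of `n` points in general position. -/
noncomputable def mu (k n : ℕ) : ℕ :=
  sInf {m | ∃ P : Finset (ℝ × ℝ), GenPos P ∧ P.card = n ∧ convexPosCount P k = m}

/-- `x` is a γ-point of `T` if `T ∪ {x}` is in convex position. -/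
def IsGammaPt (T : Finset (ℝ × ℝ)) (x : ℝ × ℝ) : Prop :=
  ConvexPos (insert x T)

/-- `x` is a β-point of `T` if `T ∪ {x}` is not in convex position and `x` does not
lie in the convex hull of `T`. -/
def IsBetaPt (T : Finset (ℝ × ℝ)) (x : ℝ × ℝ) : Prop :=
  ¬ ConvexPos (insert x T) ∧ x ∉ convexHull ℝ (T : Set (ℝ × ℝ))

open scoped Classical in
/-- `γ_T`: number of γ-points of `T` among the points of `P \ T`. -/
noncomputable def gammaCount (P T : Finset (ℝ × ℝ)) : ℕ :=
  ((P \ T).filter fun x => IsGammaPt T x).card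

open scoped Classical in
/-- `β_T`: number of β-points of `T` among the points of `P \ T`. -/
noncomputable def betaCount (P T : Finset (ℝ × ℝ)) : ℕ :=
  ((P \ T).filter fun x => IsBetaPt T x).card

open scoped Classical in
/-- Number of `k`-element subsets of `P` whose convex hull has exactly `j`
extreme points. -/
noncomputable def hullCount (P : Finset (ℝ × ℝ)) (k j : ℕ) : ℕ :=
  ((P.powersetCard k).filter fun S =>
    (Set.extremePoints ℝ (convexHull ℝ (S : Set (ℝ × ℝ)))).ncard = j).card

/-- `x` and `y` lie strictly on the same side of the line through `p` and `q`. -/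
def SameSide (p q x y : ℝ × ℝ) : Prop :=
  0 < ((q.1 - p.1) * (x.2 - p.2) - (q.2 - p.2) * (x.1 - p.1)) *
      ((q.1 - p.1) * (y.2 - p.2) - (q.2 - p.2) * (y.1 - p.1))

/-- `x` and `y` lie in the same region with respect to `T`: for each pair of
distinct points of `T`, they lie strictly on the same side of the line through them. -/
def SameRegion (T : Finset (ℝ × ℝ)) (x y : ℝ × ℝ) : Prop :=
  ∀ p ∈ T, ∀ q ∈ T, p ≠ q → SameSide p q x y

open scoped Classical in
/-- Number of 2-element subsets `{x, y}` of `P \ T` such that `x` and `y` are both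
γ-points of `T` lying in the same region with respect to `T`. -/
noncomputable def gammaSamePairs (P T : Finset (ℝ × ℝ)) : ℕ :=
  (((P \ T).powersetCard 2).filter fun S =>
    (∀ x ∈ S, IsGammaPt T x) ∧ ∀ x ∈ S, ∀ y ∈ S, x ≠ y → SameRegion T x y).card

open scoped Classical in
/-- Number of 2-element subsets `{x, y}` of `P \ T` such that `x` and `y` are both
γ-points of `T` lying in distinct regions with respect to `T`. -/
noncomputable def gammaDiffPairs (P T : Finset (ℝ × ℝ)) : ℕ :=
  (((P \ T).powersetCard 2).filter fun S =>
    (∀ x ∈ S, IsGammaPt T x) ∧ ∀ x ∈ S, ∀ y ∈ S, x ≠ y → ¬ SameRegion T x y).card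

open scoped Classical in
/-- Number of 2-element subsets `{x, y}` of `P \ T` such that `x` and `y` are both
β-points of `T` lying in the same region with respect to `T`. -/
noncomputable def betaSamePairs (P T : Finset (ℝ × ℝ)) : ℕ :=
  (((P \ T).powersetCard 2).filter fun S =>
    (∀ x ∈ S, IsBetaPt T x) ∧ ∀ x ∈ S, ∀ y ∈ S, x ≠ y → SameRegion T x y).card

open scoped Classical in
/-- Number of 2-element subsets `{x, y}` of `P \ T` such that `x` and `y` are both
β-points of `T` lying in distinct regions with respect to `T`. -/
noncomputable def betaDiffPairs (P T : Finset (ℝ × ℝ)) : ℕ :=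
  (((P \ T).powersetCard 2).filter fun S =>
    (∀ x ∈ S, IsBetaPt T x) ∧ ∀ x ∈ S, ∀ y ∈ S, x ≠ y → ¬ SameRegion T x y).card

/-- Twice the signed area of the triangle `abc`. -/
def orient (a b c : ℝ × ℝ) : ℝ := (b.1 - a.1) * (c.2 - a.2) - (b.2 - a.2) * (c.1 - a.1)

theorem collinear_of_orient_eq_zero {a b c : ℝ × ℝ} (hab : a ≠ b) (h : orient a b c = 0) :
    Collinear ℝ ({a, b, c} : Set (ℝ × ℝ)) := by
  obtain ⟨a₁, a₂⟩ := a
  obtain ⟨b₁, b₂⟩ := b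
  obtain ⟨c₁, c₂⟩ := c
  simp only [orient] at h
  rw [collinear_iff_of_mem (p₀ := (a₁, a₂)) (by simp)]
  refine ⟨(b₁ - a₁, b₂ - a₂), ?_⟩
  simp only [Set.mem_insert_iff, Set.mem_singleton_iff, forall_eq_or_imp, forall_eq, vadd_eq_add,
    Prod.smul_mk, Prod.mk_add_mk, smul_eq_mul, Prod.mk.injEq]
  refine ⟨⟨0, by simp⟩, ⟨1, by simp⟩, ?_⟩
  by_cases h₁ : b₁ = a₁
  · have h₂ : b₂ - a₂ ≠ 0 := fun h₂ => hab (by rw [h₁, sub_eq_zero.1 h₂])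
    have h₃ : c₁ - a₁ = 0 := by
      subst h₁
      simpa [h₂] using h
    refine ⟨(c₂ - a₂) / (b₂ - a₂), ?_, ?_⟩
    · rw [h₁, sub_self, mul_zero]
      linarith
    · field_simp
      ring
  · have h₂ : b₁ - a₁ ≠ 0 := sub_ne_zero.2 h₁
    refine ⟨(c₁ - a₁) / (b₁ - a₁), ?_, ?_⟩
    · field_simp
      ring
    · field_simp
      linarith

theorem GenPos.orient_ne_zero {P : Finset (ℝ × ℝ)} (hP : GenPos P) {a b c : ℝ × ℝ}
    (ha : a ∈ P) (hb : b ∈ P) (hc : c ∈ P) (hab : a ≠ b) (hac : a ≠ c) (hbc : b ≠ c) :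
    orient a b c ≠ 0 :=
  fun h => hP a ha b hb c hc hab hac hbc (collinear_of_orient_eq_zero hab h)

theorem mem_convexHull_triple_iff {E : Type*} [AddCommGroup E] [Module ℝ E] {a b c x : E} :
    x ∈ convexHull ℝ ({a, b, c} : Set E) ↔
      ∃ u v w : ℝ, 0 ≤ u ∧ 0 ≤ v ∧ 0 ≤ w ∧ u + v + w = 1 ∧ u • a + v • b + w • c = x := by
  constructor
  · rw [convexHull_insert (Set.insert_nonempty _ _), convexHull_pair, mem_convexJoin]
    rintro ⟨_, rfl, _, ⟨s, t, hs, ht, hst, rfl⟩, u, v, hu, hv, huv, rfl⟩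
    refine ⟨u, v * s, v * t, hu, by positivity, by positivity, ?_, ?_⟩
    · rw [add_assoc, ← mul_add, hst, mul_one, huv]
    · rw [smul_add, smul_smul, smul_smul, add_assoc]
  · rintro ⟨u, v, w, hu, hv, hw, hs, rfl⟩
    have := (convex_convexHull ℝ ({a, b, c} : Set E)).sum_mem (t := Finset.univ)
      (w := ![u, v, w]) (z := ![a, b, c])
      (by simp [Fin.forall_fin_succ, hu, hv, hw]) (by simpa [Fin.sum_univ_three] using hs)
      (by
        intro i _
        apply subset_convexHull
        fin_cases i <;> simp)
    simpa [Fin.sum_univ_three] using this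

theorem mem_convexHull_triple_iff_orient {a b c x : ℝ × ℝ} (h₁ : orient a b x ≠ 0)
    (h₂ : orient b c x ≠ 0) (h₃ : orient c a x ≠ 0) :
    x ∈ convexHull ℝ ({a, b, c} : Set (ℝ × ℝ)) ↔
      (0 < orient a b x ↔ 0 < orient b c x) ∧ (0 < orient b c x ↔ 0 < orient c a x) := by
  rw [mem_convexHull_triple_iff]
  constructor
  · rintro ⟨u, v, w, hu, hv, hw, hs, rfl⟩
    obtain rfl : u = 1 - v - w := by linarith
    have e₁ : orient a b ((1 - v - w) • a + v • b + w • c) = w * orient a b c := by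
      simp [orient]
      ring
    have e₂ : orient b c ((1 - v - w) • a + v • b + w • c) = (1 - v - w) * orient a b c := by
      simp [orient]
      ring
    have e₃ : orient c a ((1 - v - w) • a + v • b + w • c) = v * orient a b c := by
      simp [orient]
      ring
    rw [e₁] at h₁ ⊢
    rw [e₂] at h₂ ⊢
    rw [e₃] at h₃ ⊢
    rw [mul_pos_iff_of_pos_left (hw.lt_of_ne' (left_ne_zero_of_mul h₁)),
      mul_pos_iff_of_pos_left (hu.lt_of_ne' (left_ne_zero_of_mul h₂)),
      mul_pos_iff_of_pos_left (hv.lt_of_ne' (left_ne_zero_of_mul h₃))]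
    simp
  · rintro ⟨h₁₂, h₂₃⟩
    have hsum : orient a b x + orient b c x + orient c a x = orient a b c := by
      simp only [orient]
      ring
    have key : orient a b c ≠ 0 ∧ 0 ≤ orient a b x / orient a b c ∧
        0 ≤ orient b c x / orient a b c ∧ 0 ≤ orient c a x / orient a b c := by
      rcases h₂.lt_or_gt with h | h
      · have h₁' : orient a b x < 0 := h₁.lt_of_le (not_lt.1 fun h' => h.not_gt (h₁₂.1 h'))
        have h₃' : orient c a x < 0 := h₃.lt_of_le (not_lt.1 fun h' => h.not_gt (h₂₃.2 h'))
        have h₀ : orient a b c < 0 := by linarith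
        exact ⟨h₀.ne, (div_pos_of_neg_of_neg h₁' h₀).le, (div_pos_of_neg_of_neg h h₀).le,
          (div_pos_of_neg_of_neg h₃' h₀).le⟩
      · have h₁' := h₁₂.2 h
        have h₃' := h₂₃.1 h
        have h₀ : 0 < orient a b c := by linarith
        exact ⟨h₀.ne', (div_pos h₁' h₀).le, (div_pos h h₀).le, (div_pos h₃' h₀).le⟩
    obtain ⟨h₀, k₁, k₂, k₃⟩ := key
    refine ⟨_, _, _, k₂, k₃, k₁, ?_, ?_⟩
    · field_simp
      linarith
    · ext
      · simp only [Prod.fst_add, Prod.smul_fst, smul_eq_mul]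
        field_simp
        simp only [orient]
        ring
      · simp only [Prod.snd_add, Prod.smul_snd, smul_eq_mul]
        field_simp
        simp only [orient]
        ring

/-- The boolean sign of the orientation of a triple of points. -/
noncomputable def ccw (a b c : ℝ × ℝ) : Bool := decide (0 < orient a b c)

theorem mem_convexHull_triple_iff_ccw {a b c d : ℝ × ℝ} (h₁ : orient a b c ≠ 0)
    (h₂ : orient a b d ≠ 0) (h₃ : orient a c d ≠ 0) (h₄ : orient b c d ≠ 0) :
    (a ∈ convexHull ℝ ({b, c, d} : Set (ℝ × ℝ)) ↔
      (ccw a b c == ccw a c d && ccw a b c != ccw a b d) = true) ∧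
    (b ∈ convexHull ℝ ({a, c, d} : Set (ℝ × ℝ)) ↔
      (ccw a b d == ccw b c d && ccw a b c != ccw b c d) = true) ∧
    (c ∈ convexHull ℝ ({a, b, d} : Set (ℝ × ℝ)) ↔
      (ccw a b c == ccw a c d && ccw a b c != ccw b c d) = true) ∧
    (d ∈ convexHull ℝ ({a, b, c} : Set (ℝ × ℝ)) ↔
      (ccw a b d == ccw b c d && ccw b c d != ccw a c d) = true) := by
  have hneg {r : ℝ} (hr : r ≠ 0) : 0 < -r ↔ ¬ 0 < r := by
    rw [neg_pos, not_lt]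
    exact ⟨le_of_lt, hr.lt_of_le⟩
  have ea₁ : orient b c a = orient a b c := by simp only [orient]; ring
  have ea₂ : orient c d a = orient a c d := by simp only [orient]; ring
  have ea₃ : orient d b a = -orient a b d := by simp only [orient]; ring
  have eb₁ : orient a c b = -orient a b c := by simp only [orient]; ring
  have eb₂ : orient c d b = orient b c d := by simp only [orient]; ring
  have eb₃ : orient d a b = orient a b d := by simp only [orient]; ring
  have ec₂ : orient b d c = -orient b c d := by simp only [orient]; ring
  have ec₃ : orient d a c = orient a c d := by simp only [orient]; ring
  have ed₃ : orient c a d = -orient a c d := by simp only [orient]; ring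
  refine ⟨?_, ?_, ?_, ?_⟩
  · rw [mem_convexHull_triple_iff_orient (by rwa [ea₁]) (by rwa [ea₂]) (by simpa [ea₃]),
      ea₁, ea₂, ea₃, hneg h₂]
    by_cases k₁ : 0 < orient a b c <;> by_cases k₂ : 0 < orient a b d <;>
      by_cases k₃ : 0 < orient a c d <;> simp [ccw, k₁, k₂, k₃]
  · rw [mem_convexHull_triple_iff_orient (by simpa [eb₁]) (by rwa [eb₂]) (by rwa [eb₃]),
      eb₁, eb₂, eb₃, hneg h₁]
    by_cases k₁ : 0 < orient a b c <;> by_cases k₂ : 0 < orient a b d <;>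
      by_cases k₃ : 0 < orient b c d <;> simp [ccw, k₁, k₂, k₃]
  · rw [mem_convexHull_triple_iff_orient h₁ (by simpa [ec₂]) (by rwa [ec₃]),
      ec₂, ec₃, hneg h₄]
    by_cases k₁ : 0 < orient a b c <;> by_cases k₂ : 0 < orient a c d <;>
      by_cases k₃ : 0 < orient b c d <;> simp [ccw, k₁, k₂, k₃]
  · rw [mem_convexHull_triple_iff_orient h₂ h₄ (by simpa [ed₃]), ed₃, hneg h₃]
    by_cases k₁ : 0 < orient a b d <;> by_cases k₂ : 0 < orient a c d <;>
      by_cases k₃ : 0 < orient b c d <;> simp [ccw, k₁, k₂, k₃]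

/-- The sign condition on the four triples of `a, b, c, d` imposed by
`[bcd] - [acd] + [abd] - [abc] = 0`. -/
def quadCompatible (A B C D : Bool) : Bool := !(A == C && B == D && A != B)

/-- The sign condition imposed by a relation `x₁y₁ - x₂y₂ + x₃y₃ = 0` between nonzero reals. -/
def pluckerCompatible (x₁ y₁ x₂ y₂ x₃ y₃ : Bool) : Bool :=
  !((x₁ ^^ y₁) == (x₃ ^^ y₃) && (x₁ ^^ y₁) != (x₂ ^^ y₂))

theorem quadCompatible_ccw {a b c d : ℝ × ℝ} (h₁ : orient a b c ≠ 0)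
    (h₂ : orient a b d ≠ 0) (h₃ : orient a c d ≠ 0) (h₄ : orient b c d ≠ 0) :
    quadCompatible (ccw a b c) (ccw a b d) (ccw a c d) (ccw b c d) = true := by
  have h : orient b c d - orient a c d + orient a b d - orient a b c = 0 := by
    simp only [orient]
    ring
  rcases h₁.lt_or_gt with k₁ | k₁ <;> rcases h₂.lt_or_gt with k₂ | k₂ <;>
    rcases h₃.lt_or_gt with k₃ | k₃ <;> rcases h₄.lt_or_gt with k₄ | k₄ <;>
    first
    | (exfalso; linarith)
    | simp [quadCompatible, ccw, k₁, k₂, k₃, k₄, k₁.not_gt, k₂.not_gt, k₃.not_gt, k₄.not_gt]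

theorem decide_pos_xor_decide_pos {x y : ℝ} (hx : x ≠ 0) (hy : y ≠ 0) :
    (decide (0 < x) ^^ decide (0 < y)) = decide (x * y < 0) := by
  rcases hx.lt_or_gt with h | h <;> rcases hy.lt_or_gt with k | k
  · simp [h.not_gt, k.not_gt, (mul_pos_of_neg_of_neg h k).not_gt]
  · simp [h.not_gt, k, mul_neg_of_neg_of_pos h k]
  · simp [h, k.not_gt, mul_neg_of_pos_of_neg h k]
  · simp [h, k, (mul_pos h k).not_gt]

theorem pluckerCompatible_decide_pos {x₁ y₁ x₂ y₂ x₃ y₃ : ℝ} (hx₁ : x₁ ≠ 0) (hy₁ : y₁ ≠ 0)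
    (hx₂ : x₂ ≠ 0) (hy₂ : y₂ ≠ 0) (hx₃ : x₃ ≠ 0) (hy₃ : y₃ ≠ 0)
    (h : x₁ * y₁ - x₂ * y₂ + x₃ * y₃ = 0) :
    pluckerCompatible (decide (0 < x₁)) (decide (0 < y₁)) (decide (0 < x₂)) (decide (0 < y₂))
      (decide (0 < x₃)) (decide (0 < y₃)) = true := by
  simp only [pluckerCompatible, decide_pos_xor_decide_pos hx₁ hy₁,
    decide_pos_xor_decide_pos hx₂ hy₂, decide_pos_xor_decide_pos hx₃ hy₃]
  rcases (mul_ne_zero hx₁ hy₁).lt_or_gt with k₁ | k₁ <;>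
    rcases (mul_ne_zero hx₂ hy₂).lt_or_gt with k₂ | k₂ <;>
    rcases (mul_ne_zero hx₃ hy₃).lt_or_gt with k₃ | k₃ <;>
    first
    | (exfalso; linarith)
    | simp [k₁, k₂, k₃, k₁.not_gt, k₂.not_gt, k₃.not_gt]

/-- For five points with the given signs of the triples `012, 013, 014, 023, 024, 034, 123, 124,
134, 234`, the entry `(i, m)` tells whether point `i` lies in the triangle spanned by the three
points other than `i` and `m`. -/
def hullTable (b0 b1 b2 b3 b4 b5 b6 b7 b8 b9 : Bool) : Fin 5 → Fin 5 → Bool :=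
  let q₁ (A B C _D : Bool) := A == C && A != B
  let q₂ (A B _C D : Bool) := B == D && A != D
  let q₃ (A _B C D : Bool) := A == C && A != D
  let q₄ (_A B C D : Bool) := B == D && D != C
  ![![false, q₁ b3 b4 b5 b9, q₁ b1 b2 b5 b8, q₁ b0 b2 b4 b7, q₁ b0 b1 b3 b6],
    ![q₁ b6 b7 b8 b9, false, q₂ b1 b2 b5 b8, q₂ b0 b2 b4 b7, q₂ b0 b1 b3 b6],
    ![q₂ b6 b7 b8 b9, q₂ b3 b4 b5 b9, false, q₃ b0 b2 b4 b7, q₃ b0 b1 b3 b6],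
    ![q₃ b6 b7 b8 b9, q₃ b3 b4 b5 b9, q₃ b1 b2 b5 b8, false, q₄ b0 b1 b3 b6],
    ![q₄ b6 b7 b8 b9, q₄ b3 b4 b5 b9, q₄ b1 b2 b5 b8, q₄ b0 b2 b4 b7, false]]

/-- The number of pairs `(i, j)` such that no point lies in a triangle when `i` is left out, some
point does when `j` is left out, and `i` is not in a triangle when `j` is left out. -/
def tableCount (T : Fin 5 → Fin 5 → Bool) : ℕ :=
  ∑ i, ∑ j, if (∀ k, T k i = false) ∧ ¬ (∀ k, T k j = false) ∧ T i j = false then 1 else 0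

theorem tableCount_hullTable : ∀ b0 b1 b2 b3 b4 b5 b6 b7 b8 b9 : Bool,
    (quadCompatible b6 b7 b8 b9 && quadCompatible b3 b4 b5 b9 && quadCompatible b1 b2 b5 b8 &&
      quadCompatible b0 b2 b4 b7 && quadCompatible b0 b1 b3 b6 &&
      pluckerCompatible b0 b5 b1 b4 b2 b3 && pluckerCompatible b0 b8 b1 b7 b2 b6 &&
      pluckerCompatible b0 b9 b3 b7 b4 b6 && pluckerCompatible b1 b9 b3 b8 b5 b6 &&
      pluckerCompatible b2 b9 b4 b8 b5 b7) = true →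
    tableCount (hullTable b0 b1 b2 b3 b4 b5 b6 b7 b8 b9) =
      if ∀ j i, hullTable b0 b1 b2 b3 b4 b5 b6 b7 b8 b9 i j = false then 0 else 4 := by
  decide +kernel

/-- In general position, the incidences between points and triangles among five points are
described by a table with the expected count. -/
theorem exists_hullTable {p : Fin 5 → ℝ × ℝ}
    (hp : ∀ i j k, i < j → j < k → orient (p i) (p j) (p k) ≠ 0) :
    ∃ T : Fin 5 → Fin 5 → Bool, (∀ i, T i i = false) ∧
      (∀ i m, i ≠ m → (p i ∈ convexHull ℝ (p '' {k | k ≠ m ∧ k ≠ i}) ↔ T i m = true)) ∧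
      tableCount T = if ∀ j i, T i j = false then 0 else 4 := by
  have n0 := hp 0 1 2 (by decide) (by decide)
  have n1 := hp 0 1 3 (by decide) (by decide)
  have n2 := hp 0 1 4 (by decide) (by decide)
  have n3 := hp 0 2 3 (by decide) (by decide)
  have n4 := hp 0 2 4 (by decide) (by decide)
  have n5 := hp 0 3 4 (by decide) (by decide)
  have n6 := hp 1 2 3 (by decide) (by decide)
  have n7 := hp 1 2 4 (by decide) (by decide)
  have n8 := hp 1 3 4 (by decide) (by decide)
  have n9 := hp 2 3 4 (by decide) (by decide)
  refine ⟨hullTable (ccw (p 0) (p 1) (p 2)) (ccw (p 0) (p 1) (p 3)) (ccw (p 0) (p 1) (p 4))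
    (ccw (p 0) (p 2) (p 3)) (ccw (p 0) (p 2) (p 4)) (ccw (p 0) (p 3) (p 4))
    (ccw (p 1) (p 2) (p 3)) (ccw (p 1) (p 2) (p 4)) (ccw (p 1) (p 3) (p 4))
    (ccw (p 2) (p 3) (p 4)), ?_, ?_, ?_⟩
  · intro i
    fin_cases i <;> rfl
  · have himage {i m a b c : Fin 5} (h : ∀ k, k ≠ m ∧ k ≠ i ↔ k = a ∨ k = b ∨ k = c) :
        p '' {k | k ≠ m ∧ k ≠ i} = {p a, p b, p c} := by
      simp only [h]
      ext x
      simp [eq_comm]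
    obtain ⟨a₁, a₂, a₃, a₄⟩ := mem_convexHull_triple_iff_ccw n6 n7 n8 n9
    obtain ⟨b₁, b₂, b₃, b₄⟩ := mem_convexHull_triple_iff_ccw n3 n4 n5 n9
    obtain ⟨c₁, c₂, c₃, c₄⟩ := mem_convexHull_triple_iff_ccw n1 n2 n5 n8
    obtain ⟨d₁, d₂, d₃, d₄⟩ := mem_convexHull_triple_iff_ccw n0 n2 n4 n7
    obtain ⟨e₁, e₂, e₃, e₄⟩ := mem_convexHull_triple_iff_ccw n0 n1 n3 n6
    intro i m him
    fin_cases i <;> fin_cases m <;> first | exact absurd rfl him | skip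
    · rw [himage (a := 2) (b := 3) (c := 4) (by decide)]; exact b₁
    · rw [himage (a := 1) (b := 3) (c := 4) (by decide)]; exact c₁
    · rw [himage (a := 1) (b := 2) (c := 4) (by decide)]; exact d₁
    · rw [himage (a := 1) (b := 2) (c := 3) (by decide)]; exact e₁
    · rw [himage (a := 2) (b := 3) (c := 4) (by decide)]; exact a₁
    · rw [himage (a := 0) (b := 3) (c := 4) (by decide)]; exact c₂
    · rw [himage (a := 0) (b := 2) (c := 4) (by decide)]; exact d₂
    · rw [himage (a := 0) (b := 2) (c := 3) (by decide)]; exact e₂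
    · rw [himage (a := 1) (b := 3) (c := 4) (by decide)]; exact a₂
    · rw [himage (a := 0) (b := 3) (c := 4) (by decide)]; exact b₂
    · rw [himage (a := 0) (b := 1) (c := 4) (by decide)]; exact d₃
    · rw [himage (a := 0) (b := 1) (c := 3) (by decide)]; exact e₃
    · rw [himage (a := 1) (b := 2) (c := 4) (by decide)]; exact a₃
    · rw [himage (a := 0) (b := 2) (c := 4) (by decide)]; exact b₃
    · rw [himage (a := 0) (b := 1) (c := 4) (by decide)]; exact c₃
    · rw [himage (a := 0) (b := 1) (c := 2) (by decide)]; exact e₄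
    · rw [himage (a := 1) (b := 2) (c := 3) (by decide)]; exact a₄
    · rw [himage (a := 0) (b := 2) (c := 3) (by decide)]; exact b₄
    · rw [himage (a := 0) (b := 1) (c := 3) (by decide)]; exact c₄
    · rw [himage (a := 0) (b := 1) (c := 2) (by decide)]; exact d₄
  · apply tableCount_hullTable
    rw [quadCompatible_ccw n6 n7 n8 n9, quadCompatible_ccw n3 n4 n5 n9,
      quadCompatible_ccw n1 n2 n5 n8, quadCompatible_ccw n0 n2 n4 n7,
      quadCompatible_ccw n0 n1 n3 n6]
    simp only [Bool.true_and, Bool.and_eq_true, and_assoc, ccw]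
    refine ⟨pluckerCompatible_decide_pos n0 n5 n1 n4 n2 n3 ?_,
      pluckerCompatible_decide_pos n0 n8 n1 n7 n2 n6 ?_,
      pluckerCompatible_decide_pos n0 n9 n3 n7 n4 n6 ?_,
      pluckerCompatible_decide_pos n1 n9 n3 n8 n5 n6 ?_,
      pluckerCompatible_decide_pos n2 n9 n4 n8 n5 n7 ?_⟩ <;>
    · simp only [orient]
      ring

theorem convexPos_iff_notMem_convexHull {S : Finset (ℝ × ℝ)} :
    ConvexPos S ↔ ∀ x ∈ S, x ∉ convexHull ℝ ((S.erase x : Finset (ℝ × ℝ)) : Set (ℝ × ℝ)) := by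
  have hconv := convex_convexHull ℝ (S : Set (ℝ × ℝ))
  refine forall₂_congr fun x hx => ⟨fun h h' => ?_, fun h => ?_⟩
  · rw [hconv.mem_extremePoints_iff_mem_sdiff_convexHull_sdiff] at h
    refine h.2 (convexHull_mono ?_ h')
    rw [Finset.coe_erase]
    exact Set.sdiff_subset_sdiff_left (subset_convexHull ℝ _)
  · by_contra hne
    have hext : Set.extremePoints ℝ (convexHull ℝ (S : Set (ℝ × ℝ))) ⊆ S.erase x := fun y hy =>
      Finset.mem_coe.2 (Finset.mem_erase.2
        ⟨fun hyx => hne (hyx ▸ hy), Finset.mem_coe.1 (extremePoints_convexHull_subset hy)⟩)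
    have hsub := closure_minimal (convexHull_mono (𝕜 := ℝ) hext)
      ((S.erase x).finite_toSet.isClosed_convexHull ℝ)
    rw [closure_convexHull_extremePoints (S.finite_toSet.isCompact_convexHull ℝ) hconv] at hsub
    exact h (hsub (subset_convexHull ℝ _ hx))

theorem convexPos_iff_forall_erase {S : Finset (ℝ × ℝ)} (hS : 5 ≤ S.card) :
    ConvexPos S ↔ ∀ m ∈ S, ConvexPos (S.erase m) := by
  simp only [convexPos_iff_notMem_convexHull]
  constructor
  · intro h m _ x hx hx'
    refine h x (Finset.mem_of_mem_erase hx) (convexHull_mono ?_ hx')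
    exact Finset.coe_subset.2 (Finset.erase_subset_erase _ (Finset.erase_subset _ _))
  · intro h x hx hx'
    rw [convexHull_eq_union (𝕜 := ℝ)] at hx'
    simp only [Set.mem_iUnion] at hx'
    obtain ⟨t, ht, hind, hxt⟩ := hx'
    have htcard : t.card ≤ 3 := by
      have := hind.card_le_finrank_succ
      simp only [Fintype.card_coe] at this
      have hle := Submodule.finrank_le (vectorSpan ℝ (Set.range ((↑) : t → ℝ × ℝ)))
      have : Module.finrank ℝ (ℝ × ℝ) = 2 := by simp
      omega
    obtain ⟨m, hm, hmt⟩ := Finset.exists_mem_notMem_of_card_lt_card (s := t) (t := S.erase x)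
      (by rw [Finset.card_erase_of_mem hx]; omega)
    obtain ⟨hmx, hmS⟩ := Finset.mem_erase.1 hm
    refine h m hmS x (Finset.mem_erase.2 ⟨hmx.symm, hx⟩) (convexHull_mono ?_ hxt)
    intro y hy
    obtain ⟨hyx, hyS⟩ := Finset.mem_erase.1 (Finset.mem_coe.1 (ht hy))
    exact Finset.mem_coe.2 (Finset.mem_erase.2
      ⟨hyx, Finset.mem_erase.2 ⟨fun h => hmt (h ▸ hy), hyS⟩⟩)

open scoped Classical in
/-- The ordered pairs `(x, y)` of distinct points of `S` such that `x` is a β-point and `y` is a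
γ-point of `S \ {x, y}`. -/
noncomputable def betaGammaPairs (S : Finset (ℝ × ℝ)) : Finset ((ℝ × ℝ) × (ℝ × ℝ)) :=
  S.offDiag.filter fun z =>
    IsBetaPt ((S.erase z.2).erase z.1) z.1 ∧ IsGammaPt ((S.erase z.2).erase z.1) z.2

open scoped Classical in
theorem card_betaGammaPairs {S : Finset (ℝ × ℝ)} (hgp : GenPos S) (hS : S.card = 5) :
    (betaGammaPairs S).card = if ConvexPos S then 0 else 4 := by
  let e := (S.equivFinOfCardEq hS).symm
  let p : Fin 5 → ℝ × ℝ := fun i => e i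
  have hpS (i) : p i ∈ S := (e i).2
  have hinj : Function.Injective p := Subtype.val_injective.comp e.injective
  have hsurj : ∀ x ∈ S, ∃ i, p i = x := fun x hx => ⟨e.symm ⟨x, hx⟩, by simp [p]⟩
  obtain ⟨T, hdiag, hT, hcount⟩ := exists_hullTable (p := p) fun i j k hij hjk =>
    hgp.orient_ne_zero (hpS i) (hpS j) (hpS k) (hinj.ne hij.ne) (hinj.ne (hij.trans hjk).ne)
      (hinj.ne hjk.ne)
  have hull {i m : Fin 5} (him : i ≠ m) :
      p i ∈ convexHull ℝ (((S.erase (p m)).erase (p i) : Finset (ℝ × ℝ)) : Set (ℝ × ℝ)) ↔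
        T i m = true := by
    rw [← hT i m him]
    congr! 2
    ext x
    simp only [Finset.coe_erase, Set.mem_sdiff, Finset.mem_coe, Set.mem_singleton_iff,
      Set.mem_image, Set.mem_ofPred_eq]
    constructor
    · rintro ⟨⟨hx, hxm⟩, hxi⟩
      obtain ⟨k, rfl⟩ := hsurj x hx
      exact ⟨k, ⟨fun h => hxm (h ▸ rfl), fun h => hxi (h ▸ rfl)⟩, rfl⟩
    · rintro ⟨k, ⟨hkm, hki⟩, rfl⟩
      exact ⟨⟨hpS k, hinj.ne hkm⟩, hinj.ne hki⟩
  have convex_erase (m : Fin 5) : ConvexPos (S.erase (p m)) ↔ ∀ k, T k m = false := by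
    rw [convexPos_iff_notMem_convexHull]
    constructor
    · intro h k
      by_cases hkm : k = m
      · rw [hkm, hdiag]
      · have := h (p k) (Finset.mem_erase.2 ⟨hinj.ne hkm, hpS k⟩)
        rwa [hull hkm, Bool.not_eq_true] at this
    · intro h x hx
      obtain ⟨hxm, hxS⟩ := Finset.mem_erase.1 hx
      obtain ⟨k, rfl⟩ := hsurj x hxS
      rw [hull (fun hkm : k = m => hxm (hkm ▸ rfl)), h k]
      simp
  have convex_iff : ConvexPos S ↔ ∀ j i, T i j = false := by
    rw [convexPos_iff_forall_erase hS.ge]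
    simp only [← convex_erase]
    exact ⟨fun h j => h _ (hpS j), fun h m hm => by
      obtain ⟨j, rfl⟩ := hsurj m hm
      exact h j⟩
  have hpairs : betaGammaPairs S = (Finset.univ.filter fun z : Fin 5 × Fin 5 =>
      (∀ k, T k z.1 = false) ∧ ¬ (∀ k, T k z.2 = false) ∧ T z.1 z.2 = false).image
        (Prod.map p p) := by
    have key {i j : Fin 5} (hij : i ≠ j) :
        (IsBetaPt ((S.erase (p j)).erase (p i)) (p i) ∧
          IsGammaPt ((S.erase (p j)).erase (p i)) (p j)) ↔
        (∀ k, T k i = false) ∧ ¬ (∀ k, T k j = false) ∧ T i j = false := by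
      have h₁ : insert (p i) ((S.erase (p j)).erase (p i)) = S.erase (p j) :=
        Finset.insert_erase (Finset.mem_erase.2 ⟨hinj.ne hij, hpS i⟩)
      have h₂ : insert (p j) ((S.erase (p j)).erase (p i)) = S.erase (p i) := by
        rw [Finset.erase_right_comm]
        exact Finset.insert_erase (Finset.mem_erase.2 ⟨hinj.ne hij.symm, hpS j⟩)
      unfold IsBetaPt IsGammaPt
      rw [h₁, h₂, convex_erase, convex_erase, hull hij, Bool.not_eq_true]
      tauto
    ext ⟨x, y⟩
    simp only [betaGammaPairs, Finset.mem_filter, Finset.mem_offDiag, Finset.mem_image,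
      Finset.mem_univ, true_and, Prod.exists, Prod.map_apply, Prod.mk.injEq]
    constructor
    · rintro ⟨⟨hx, hy, hxy⟩, h⟩
      obtain ⟨i, rfl⟩ := hsurj x hx
      obtain ⟨j, rfl⟩ := hsurj y hy
      exact ⟨i, j, (key fun hij : i = j => hxy (hij ▸ rfl)).1 h, rfl, rfl⟩
    · rintro ⟨i, j, h, rfl, rfl⟩
      have hij : i ≠ j := by
        rintro rfl
        exact h.2.1 h.1
      exact ⟨⟨hpS i, hpS j, hinj.ne hij⟩, (key hij).2 h⟩
  rw [hpairs, Finset.card_image_of_injective _ (hinj.prodMap hinj), Finset.card_filter,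
    Fintype.sum_prod_type]
  simp only [convex_iff]
  convert hcount
  unfold tableCount
  congr!

open scoped Classical in
theorem sum_betaCount_mul_gammaCount (P : Finset (ℝ × ℝ)) :
    ∑ T ∈ P.powersetCard 3, betaCount P T * gammaCount P T =
      ∑ S ∈ P.powersetCard 5, (betaGammaPairs S).card := by
  simp only [betaCount, gammaCount, ← Finset.card_product]
  rw [← Finset.card_sigma, ← Finset.card_sigma]
  refine Finset.card_nbij' (fun a => ⟨insert a.2.2 (insert a.2.1 a.1), a.2⟩)
    (fun a => ⟨(a.1.erase a.2.2).erase a.2.1, a.2⟩) ?_ ?_ ?_ ?_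
  · rintro ⟨T, x, y⟩ h
    simp only [Finset.coe_sigma, Set.mem_sigma_iff, Finset.mem_coe, Finset.mem_powersetCard,
      Finset.mem_product, Finset.mem_filter, Finset.mem_sdiff] at h ⊢
    obtain ⟨⟨hTP, hT⟩, ⟨⟨hxP, hxT⟩, hx⟩, ⟨hyP, hyT⟩, hy⟩ := h
    have hxy : x ≠ y := by
      rintro rfl
      exact hx.1 hy
    have hy' : y ∉ insert x T := by simp [hxy.symm, hyT]
    refine ⟨⟨?_, ?_⟩, ?_⟩
    · simp [Finset.insert_subset_iff, hxP, hyP, hTP]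
    · rw [Finset.card_insert_of_notMem hy', Finset.card_insert_of_notMem hxT, hT]
    · simp only [betaGammaPairs, Finset.mem_filter, Finset.mem_offDiag]
      rw [Finset.erase_insert hy', Finset.erase_insert hxT]
      exact ⟨⟨by simp, by simp, hxy⟩, hx, hy⟩
  · rintro ⟨S, x, y⟩ h
    simp only [Finset.coe_sigma, Set.mem_sigma_iff, Finset.mem_coe, Finset.mem_powersetCard,
      Finset.mem_product, Finset.mem_filter, Finset.mem_sdiff, betaGammaPairs,
      Finset.mem_offDiag] at h ⊢
    obtain ⟨⟨hSP, hS⟩, ⟨hxS, hyS, hxy⟩, hx, hy⟩ := h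
    have hxS' : x ∈ S.erase y := Finset.mem_erase.2 ⟨hxy, hxS⟩
    refine ⟨⟨?_, ?_⟩, ⟨⟨hSP hxS, ?_⟩, hx⟩, ⟨hSP hyS, ?_⟩, hy⟩
    · exact ((Finset.erase_subset _ _).trans (Finset.erase_subset _ _)).trans hSP
    · rw [Finset.card_erase_of_mem hxS', Finset.card_erase_of_mem hyS, hS]
    · simp
    · simp
  · rintro ⟨T, x, y⟩ h
    simp only [Finset.coe_sigma, Set.mem_sigma_iff, Finset.mem_coe, Finset.mem_powersetCard,
      Finset.mem_product, Finset.mem_filter, Finset.mem_sdiff] at h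
    obtain ⟨⟨hTP, hT⟩, ⟨⟨hxP, hxT⟩, hx⟩, ⟨hyP, hyT⟩, hy⟩ := h
    have hxy : x ≠ y := by
      rintro rfl
      exact hx.1 hy
    have hy' : y ∉ insert x T := by simp [hxy.symm, hyT]
    simp only [Finset.erase_insert hy', Finset.erase_insert hxT]
  · rintro ⟨S, x, y⟩ h
    simp only [Finset.coe_sigma, Set.mem_sigma_iff, Finset.mem_coe, Finset.mem_powersetCard,
      Finset.mem_filter, betaGammaPairs, Finset.mem_offDiag] at h
    obtain ⟨⟨hSP, hS⟩, ⟨hxS, hyS, hxy⟩, hx, hy⟩ := h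
    have hxS' : x ∈ S.erase y := Finset.mem_erase.2 ⟨hxy, hxS⟩
    simp only [Finset.insert_erase hxS', Finset.insert_erase hyS]

/-- For any point placement `P` of `n` points,
`4·P₅(P) = 4·C(n,5) − ∑_T β_T·γ_T`. -/
theorem pentagon_beta_gamma_count (P : Finset (ℝ × ℝ)) (n : ℕ) (hgp : GenPos P)
    (hcard : P.card = n) :
    (4 * convexPosCount P 5 : ℤ) =
      4 * n.choose 5 - ∑ T ∈ P.powersetCard 3, (betaCount P T : ℤ) * gammaCount P T := by
  classical
  have hsum : ∑ T ∈ P.powersetCard 3, betaCount P T * gammaCount P T + 4 * convexPosCount P 5 =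
      4 * n.choose 5 := by
    rw [sum_betaCount_mul_gammaCount, ← hcard, ← Finset.card_powersetCard, convexPosCount,
      Finset.card_filter, Finset.mul_sum, ← Finset.sum_add_distrib, mul_comm 4, ← smul_eq_mul,
      ← Finset.sum_const]
    refine Finset.sum_congr rfl fun S hS => ?_
    obtain ⟨hSP, hS⟩ := Finset.mem_powersetCard.1 hS
    have hgpS : GenPos S := fun x hx y hy z hz => hgp x (hSP hx) y (hSP hy) z (hSP hz)
    rw [card_betaGammaPairs hgpS hS]
    by_cases h : ConvexPos S <;> simp [h]
  have := congrArg (Nat.cast (R := ℤ)) hsum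
  push_cast at this
  linarith
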